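/- arXiv:1609.03478 — 2 statements merged into one kernel-verified Lean document; each statement's English description precedes it below -/
import Mathlib

section
/- There exist a finite type V, a relation r : V → V → Prop, a seed vertex s ∈ V, sets B₁ ⊆ B₂ ⊆ V, and a vertex u ∈ V with u ∉ B₂, such that f(B₁ ∪ {u}) − f(B₁) < f(B₂ ∪ {u}) − f(B₂), where for B ⊆ V the set reach_B(s) is the set of vertices reachable from s (including s itself) under the reflexive-transitive closure of the restricted step relation (x steps to y iff x ∈ B and r x y), and f(B) is the cardinality of reach_B(s). Hence the boosted influence spread is not a submodular function of the boost set. -/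
/-- The set of vertices reachable from the seed `s` (including `s` itself) under
the step relation restricted to a boost set `B`: `x` steps to `y` iff `x ∈ B` and
`r x y`. -/
def boostReach {V : Type*} (r : V → V → Prop) (B : Set V) (s : V) : Set V :=
  {y | Relation.ReflTransGen (fun x y => x ∈ B ∧ r x y) s y}

/-- Theorem 2 of the paper: the boosted influence spread is not a submodular
function of the boost set. There is a finite graph, a seed `s`, boost sets
`B₁ ⊆ B₂` and a node `u ∉ B₂` such that the marginal gain of `u` at `B₁` is
strictly smaller than its marginal gain at `B₂`, where the spread of `B` is the
number of vertices reachable from `s` along edges whose tail lies in `B`. -/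
theorem boost_spread_not_submodular :
    ∃ (V : Type) (_ : Fintype V) (r : V → V → Prop) (s : V)
      (B₁ B₂ : Set V) (u : V), B₁ ⊆ B₂ ∧ u ∉ B₂ ∧
      ((boostReach r (B₁ ∪ {u}) s).ncard : ℤ) - ((boostReach r B₁ s).ncard : ℤ) <
        ((boostReach r (B₂ ∪ {u}) s).ncard : ℤ) - ((boostReach r B₂ s).ncard : ℤ) := by
  -- The directed path `0 → 1 → 2` with `B₁ = ∅`, `B₂ = {0}`, `u = 1`.
  let r : Fin 3 → Fin 3 → Prop := fun x y => x.val + 1 = y.val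
  have h1 : boostReach r (∅ ∪ {1}) 0 = {0} := by
    ext y
    constructor
    · intro h
      induction h with
      | refl => rfl
      | tail _ h ih => 
        rw [Set.mem_singleton_iff] at ih
        subst ih
        simp at h
    · rintro rfl
      exact Relation.ReflTransGen.refl
  have h2 : boostReach r ∅ 0 = {0} := by
    ext y
    constructor
    · intro h
      induction h with
      | refl => rfl
      | tail _ h ih => exact absurd h.1 (Set.notMem_empty _)
    · rintro rfl
      exact Relation.ReflTransGen.refl
  have h3 : boostReach r ({0} ∪ {1}) 0 = Set.univ := by
    have e1 : Relation.ReflTransGen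
        (fun x y => x ∈ ({0} ∪ {1} : Set (Fin 3)) ∧ r x y) 0 1 :=
      Relation.ReflTransGen.single ⟨by simp, rfl⟩
    ext y
    simp only [Set.mem_univ, iff_true]
    fin_cases y
    · exact Relation.ReflTransGen.refl
    · exact e1
    · exact e1.tail ⟨by simp, rfl⟩
  have h4 : boostReach r {0} 0 = {0, 1} := by
    ext y
    constructor
    · intro h
      induction h with
      | refl => simp
      | tail _ h ih =>
        obtain ⟨hb, hr⟩ := h
        rw [Set.mem_singleton_iff] at hb
        subst hb
        right
        exact Fin.ext hr.symm
    · rintro (rfl | rfl)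
      · exact Relation.ReflTransGen.refl
      · exact Relation.ReflTransGen.single ⟨rfl, rfl⟩
  refine ⟨Fin 3, inferInstance, r, 0, ∅, {0}, 1, Set.empty_subset _, by simp, ?_⟩
  rw [h1, h2, h3, h4, Set.ncard_univ, Set.ncard_pair (by decide)]
  simp
end

section
/- Let U be a finite set with |U| = n, let X₁, …, X_m ⊆ U, and let k ≤ m. Build the directed bipartite graph on vertex set {1,…,m} ⊔ U with an edge from i to x iff x ∈ X_i, take seed set S = {1,…,m} (all left vertices), and for a set B of left vertices let reach_B(S) be the set of vertices reachable from some seed in S (including all of S) under the reflexive-transitive closure of the restricted step relation (a vertex steps along an edge iff it lies in B). Then there exists a k-element set I ⊆ {1,…,m} with ⋃_{i ∈ I} X_i = U if and only if there exists a k-element set B of left vertices with |reach_B(S)| ≥ m + n. -/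
/-- The set of vertices reachable from some seed in `S` (including all of `S`)
under the step relation restricted to a boost set `B`: `x` steps to `y` iff
`x ∈ B` and `r x y`. -/
def boostReachFrom {V : Type*} (r : V → V → Prop) (B S : Set V) : Set V :=
  {y | ∃ s ∈ S, Relation.ReflTransGen (fun x y => x ∈ B ∧ r x y) s y}

/-- Correctness of the Set-Cover reduction in Theorem 1 of the paper: on the
directed bipartite graph over `Fin m ⊕ U` with an edge from `i` to `x` iff
`x ∈ X i`, with all left vertices as seeds, there is a `k`-element set `I` with
`⋃_{i ∈ I} X i = U` iff there is a `k`-element boost set `B` of left vertices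
whose reachable set has at least `m + n` vertices. -/
theorem boost_set_cover_reduction {U : Type*} [Fintype U] (n m k : ℕ)
    (hn : Fintype.card U = n) (X : Fin m → Set U) (hk : k ≤ m) :
    (∃ I : Finset (Fin m), I.card = k ∧ (⋃ i ∈ I, X i) = Set.univ) ↔
      (∃ B : Finset (Fin m), B.card = k ∧
        (boostReachFrom
            (fun a b => ∃ i x, a = Sum.inl i ∧ b = Sum.inr x ∧ x ∈ X i)
            (Sum.inl '' (B : Set (Fin m)))
            (Set.range (Sum.inl : Fin m → Fin m ⊕ U))).ncard ≥ m + n) := by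
  refine exists_congr fun B => and_congr_right fun _ => ?_
  have hc : Nat.card (Fin m ⊕ U) = m + n := by
    simp [Nat.card_eq_fintype_card, hn]
  have key : ∀ R : Set (Fin m ⊕ U), R.ncard ≥ m + n ↔ R = Set.univ := by
    intro R
    constructor
    · intro h
      apply Set.eq_of_subset_of_ncard_le (Set.subset_univ R)
      rw [Set.ncard_univ, hc]
      exact h
    · rintro rfl
      rw [Set.ncard_univ, hc]
  rw [key, Set.eq_univ_iff_forall, Set.eq_univ_iff_forall]
  constructor
  · rintro h (i | x)
    · exact ⟨Sum.inl i, ⟨i, rfl⟩, Relation.ReflTransGen.refl⟩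
    · obtain ⟨i, hi, hx⟩ := Set.mem_iUnion₂.1 (h x)
      exact ⟨Sum.inl i, ⟨i, rfl⟩,
        Relation.ReflTransGen.single ⟨⟨i, hi, rfl⟩, i, x, rfl, rfl, hx⟩⟩
  · intro h x
    obtain ⟨s, ⟨j, rfl⟩, hr⟩ := h (Sum.inr x)
    rcases Relation.ReflTransGen.cases_tail hr with h | ⟨c, _, ⟨i, hi, hic⟩, i', x', hc', hx', hm⟩
    · cases h
    · subst hic
      cases hc'
      cases hx'
      exact Set.mem_iUnion₂.2 ⟨i, hi, hm⟩
end
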